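/- arXiv:2408.00964 — 4 statements merged into one kernel-verified Lean document; each statement's English description precedes it below -/
import Mathlib

section
/- Let X be a finite nonempty set, L : X → ℝ a loss function, and r* ∈ X a minimizer of L (i.e., L(r*) ≤ L(r) for all r ∈ X). Then the function λ ↦ σ(λ, r*) = exp(-λ·L(r*)) / Σ_{r∈X} exp(-λ·L(r)) is monotone nondecreasing on the interval [0, ∞). -/
open Real Finset

/-- Proposition 2: the logit probability of the best strategy is
nondecreasing in the rationality level `λ` on `[0, ∞)`. -/
theorem qre_best_strategy_prob_monotone
    (X : Type*) [Fintype X] [Nonempty X] (L : X → ℝ) (rstar : X)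
    (hmin : ∀ r : X, L rstar ≤ L r) :
    MonotoneOn
      (fun lam : ℝ =>
        Real.exp (-lam * L rstar) / ∑ r : X, Real.exp (-lam * L r))
      (Set.Ici (0 : ℝ)) := by
  intro a _ b _ hab
  have hpos (c : ℝ) : 0 < ∑ r : X, Real.exp (-c * L r) :=
    Finset.sum_pos (fun r _ => Real.exp_pos _) Finset.univ_nonempty
  refine (div_le_div_iff₀ (hpos a) (hpos b)).2 ?_
  rw [Finset.mul_sum, Finset.mul_sum]
  refine Finset.sum_le_sum fun r _ => ?_
  rw [← Real.exp_add, ← Real.exp_add, Real.exp_le_exp]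
  linarith [mul_nonneg (sub_nonneg.2 hab) (sub_nonneg.2 (hmin r))]
end

section
/- Let X be a finite nonempty set, L : X → ℝ, r* ∈ X a strict minimizer of L (L(r*) < L(r) for all r ≠ r*), and suppose X has at least two elements. Then for every λ ≥ 0, the function λ ↦ σ(λ, r*) = exp(-λ·L(r*)) / Σ_{r∈X} exp(-λ·L(r)) is strictly increasing on [0, ∞). -/
open Real Finset

/-- Strict form of Proposition 2: with a strict minimizer and at least two
strategies, the logit probability of the best strategy is strictly increasing
in `λ` on `[0, ∞)`. -/
theorem qre_best_strategy_prob_strictMono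
    (X : Type*) [Fintype X] [Nonempty X] (L : X → ℝ) (rstar : X)
    (hmin : ∀ r : X, r ≠ rstar → L rstar < L r)
    (hcard : 2 ≤ Fintype.card X) :
    StrictMonoOn
      (fun lam : ℝ =>
        Real.exp (-lam * L rstar) / ∑ r : X, Real.exp (-lam * L r))
      (Set.Ici (0 : ℝ)) := by
  intro a _ b _ hab
  have : Nontrivial X := Fintype.one_lt_card_iff_nontrivial.mp hcard
  obtain ⟨s, hs⟩ := exists_ne rstar
  have hsum_pos (t : ℝ) : 0 < ∑ r : X, Real.exp (-t * L r) :=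
    Finset.sum_pos (fun r _ => Real.exp_pos _) Finset.univ_nonempty
  have hterm (r : X) (hr : r ≠ rstar) :
      Real.exp (-a * L rstar) * Real.exp (-b * L r) <
        Real.exp (-b * L rstar) * Real.exp (-a * L r) := by
    rw [← Real.exp_add, ← Real.exp_add, Real.exp_lt_exp]
    linarith [mul_pos (sub_pos.mpr hab) (sub_pos.mpr (hmin r hr))]
  refine (div_lt_div_iff₀ (hsum_pos a) (hsum_pos b)).mpr ?_
  rw [Finset.mul_sum, Finset.mul_sum]
  refine Finset.sum_lt_sum (fun r _ => ?_) ⟨s, Finset.mem_univ s, hterm s hs⟩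
  obtain rfl | hr := eq_or_ne r rstar
  · exact (mul_comm _ _).le
  · exact (hterm r hr).le
end

section
/- Fix R ∈ ℝ, λ > 0, and a finite nonempty set S of real numbers. Define, for A > 0, f(A) = exp(-λ·√A·e^{-R/2}) / (exp(-λ·√A·e^{-R/2}) + Σ_{r̂∈S} exp(-λ·A·e^{-(R - r̂)})). If A > 0 is such that for every r̂ ∈ S one has e^{-(R - r̂)} > (1/2)·e^{-R/2}/√A, then f has a strictly positive derivative at A. -/
open Real Finset

/-- Case (ii) of Proposition 3: under the stated sign condition, the QRE
probability of the best strategy has strictly positive derivative in `A`. -/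
theorem qre_prob_deriv_pos_in_loss
    (R lam : ℝ) (hlam : 0 < lam) (S : Finset ℝ) (hS : S.Nonempty)
    (A : ℝ) (hA : 0 < A)
    (hcond : ∀ rhat ∈ S,
      (1 / 2) * Real.exp (-R / 2) / Real.sqrt A < Real.exp (-(R - rhat))) :
    ∃ d : ℝ, 0 < d ∧
      HasDerivAt
        (fun a : ℝ =>
          Real.exp (-lam * (Real.sqrt a * Real.exp (-R / 2))) /
            (Real.exp (-lam * (Real.sqrt a * Real.exp (-R / 2))) +
              ∑ rhat ∈ S, Real.exp (-lam * (a * Real.exp (-(R - rhat))))))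
        d A := by
  have hg : HasDerivAt (fun a : ℝ => Real.exp (-lam * (Real.sqrt a * Real.exp (-R / 2))))
      (Real.exp (-lam * (Real.sqrt A * Real.exp (-R / 2))) *
        (-lam * (1 / (2 * Real.sqrt A) * Real.exp (-R / 2)))) A :=
    (((Real.hasDerivAt_sqrt hA.ne').mul_const _).const_mul _).exp
  have hG : HasDerivAt
      (fun a : ℝ => ∑ rhat ∈ S, Real.exp (-lam * (a * Real.exp (-(R - rhat)))))
      (∑ rhat ∈ S, Real.exp (-lam * (A * Real.exp (-(R - rhat)))) *
        (-lam * (1 * Real.exp (-(R - rhat))))) A :=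
    HasDerivAt.fun_sum fun rhat _ =>
      (((hasDerivAt_id A).mul_const (Real.exp (-(R - rhat)))).const_mul (-lam)).exp
  have hden : 0 < Real.exp (-lam * (Real.sqrt A * Real.exp (-R / 2))) +
      ∑ rhat ∈ S, Real.exp (-lam * (A * Real.exp (-(R - rhat)))) := by positivity
  refine ⟨_, ?_, hg.fun_div (hg.fun_add hG) hden.ne'⟩
  refine div_pos ?_ (pow_pos hden 2)
  have hsum : 0 < ∑ rhat ∈ S, Real.exp (-lam * (A * Real.exp (-(R - rhat)))) *
      (Real.exp (-(R - rhat)) - 1 / (2 * Real.sqrt A) * Real.exp (-R / 2)) := by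
    refine Finset.sum_pos (fun rhat hr => mul_pos (Real.exp_pos _) ?_) hS
    have hlt := hcond rhat hr
    have heq : (1 / 2) * Real.exp (-R / 2) / Real.sqrt A =
        1 / (2 * Real.sqrt A) * Real.exp (-R / 2) := by
      field_simp
    linarith
  have hpos := mul_pos (mul_pos hlam
    (Real.exp_pos (-lam * (Real.sqrt A * Real.exp (-R / 2))))) hsum
  simp only [mul_sub, Finset.sum_sub_distrib, ← Finset.sum_mul] at hpos
  have hG' : (∑ rhat ∈ S, Real.exp (-lam * (A * Real.exp (-(R - rhat)))) *
        (-lam * (1 * Real.exp (-(R - rhat))))) =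
      -lam * ∑ rhat ∈ S, Real.exp (-lam * (A * Real.exp (-(R - rhat)))) *
        Real.exp (-(R - rhat)) := by
    rw [Finset.mul_sum]
    exact Finset.sum_congr rfl fun _ _ => by ring
  rw [hG']
  linarith
end

section
/- Let X be a finite nonempty set, L : X → ℝ, r* ∈ X a minimizer of L, and λ ≥ 0. Then Σ_{r∈X} (L(r) - L(r*))·exp(-λ·L(r)) ≥ 0, and consequently the derivative of λ ↦ exp(-λ·L(r*)) / Σ_{r∈X} exp(-λ·L(r)) at any λ ≥ 0 is nonnegative. -/
open Real Finset

theorem hasDerivAt_exp_neg_mul (a x : ℝ) :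
    HasDerivAt (fun l : ℝ => Real.exp (-l * a)) (-a * Real.exp (-x * a)) x := by
  simpa [mul_comm] using ((hasDerivAt_id x).neg.mul_const a).exp

/-- The logit choice probability of `s` has derivative
`σ(s) * ∑ r, (L r - L s) * σ(r)` in the rationality parameter. -/
theorem hasDerivAt_logit {X : Type*} [Fintype X] [Nonempty X] (L : X → ℝ) (s : X) (x : ℝ) :
    HasDerivAt (fun l : ℝ => Real.exp (-l * L s) / ∑ r : X, Real.exp (-l * L r))
      (Real.exp (-x * L s) * (∑ r : X, (L r - L s) * Real.exp (-x * L r)) /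
        (∑ r : X, Real.exp (-x * L r)) ^ 2) x := by
  have hpos : 0 < ∑ r : X, Real.exp (-x * L r) :=
    Finset.sum_pos (fun r _ => Real.exp_pos _) Finset.univ_nonempty
  have hsum : HasDerivAt (fun l : ℝ => ∑ r : X, Real.exp (-l * L r))
      (∑ r : X, -L r * Real.exp (-x * L r)) x :=
    HasDerivAt.fun_sum fun r _ => hasDerivAt_exp_neg_mul (L r) x
  refine ((hasDerivAt_exp_neg_mul (L s) x).fun_div hsum hpos.ne').congr_deriv ?_
  congr 1
  simp only [sub_mul, neg_mul, Finset.sum_sub_distrib, Finset.sum_neg_distrib, ← Finset.mul_sum]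
  ring

/-- Sign analysis in Proposition 2: the numerator of the derivative is
nonnegative, and hence the derivative of the logit probability of the best
strategy is nonnegative at every `λ ≥ 0`. -/
theorem qre_derivative_nonneg
    (X : Type*) [Fintype X] [Nonempty X] (L : X → ℝ) (rstar : X)
    (hmin : ∀ r : X, L rstar ≤ L r) (lam : ℝ) (hlam : 0 ≤ lam) :
    (0 ≤ ∑ r : X, (L r - L rstar) * Real.exp (-lam * L r)) ∧
      ∃ d : ℝ, 0 ≤ d ∧
        HasDerivAt
          (fun l : ℝ =>
            Real.exp (-l * L rstar) / ∑ r : X, Real.exp (-l * L r))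
          d lam := by
  have hnum : 0 ≤ ∑ r : X, (L r - L rstar) * Real.exp (-lam * L r) :=
    Finset.sum_nonneg fun r _ => mul_nonneg (sub_nonneg.2 (hmin r)) (Real.exp_pos _).le
  exact ⟨hnum, _, by positivity, hasDerivAt_logit L rstar lam⟩
end
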